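/- Assume 𝒥 is independent and P ⊆ G satisfies the Toeplitz condition. Then G acts topologically freely on (∂Σ)·G if and only if the subgroup G₀ acts topologically freely on (∂Σ)·G (by restricting the G-action). -/

import Mathlib

variable {G : Type*} [Group G]

/-- Left translate `g·X = {gx : x ∈ X}`. -/
def lmul (g : G) (X : Set G) : Set G := (g * ·) '' X

/-- `p⁻¹X = {y ∈ P : py ∈ X}`. -/
def presub (P : Submonoid G) (p : G) (X : Set G) : Set G := {y : G | y ∈ P ∧ p * y ∈ X}

/-- The constructible right ideals of `P`: the smallest family of subsets of `P`
containing `∅` and `P` and closed under `X ↦ pX` and `X ↦ p⁻¹X` for `p ∈ P`. -/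
inductive IsConstructible (P : Submonoid G) : Set G → Prop
  | empty : IsConstructible P ∅
  | base : IsConstructible P (P : Set G)
  | mul {p : G} (hp : p ∈ P) {X : Set G} (hX : IsConstructible P X) : IsConstructible P (lmul p X)
  | pre {p : G} (hp : p ∈ P) {X : Set G} (hX : IsConstructible P X) :
      IsConstructible P (presub P p X)

/-- `𝒥_P^G`: the smallest family of subsets of `G` containing `𝒥`, closed under left
translations by group elements and under finite intersections. -/
inductive IsConstructibleG (P : Submonoid G) : Set G → Prop
  | base {X : Set G} (hX : IsConstructible P X) : IsConstructibleG P X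
  | translate (g : G) {Y : Set G} (hY : IsConstructibleG P Y) : IsConstructibleG P (lmul g Y)
  | inter {Y₁ Y₂ : Set G} (h1 : IsConstructibleG P Y₁) (h2 : IsConstructibleG P Y₂) :
      IsConstructibleG P (Y₁ ∩ Y₂)

/-- A family of subsets (containing `∅` and closed under finite intersections) is
independent if whenever a member equals a finite union of members, it equals one of them. -/
def IsIndepFamily {α : Type*} (J : Set (Set α)) : Prop :=
  ∀ X ∈ J, ∀ n : ℕ, 0 < n → ∀ Xs : Fin n → Set α,
    (∀ i, Xs i ∈ J) → X = ⋃ i, Xs i → ∃ i, X = Xs i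

/-- The Toeplitz condition for `P ⊆ G` (set-theoretic form): for every `g ∈ G` with
`{x ∈ P : gx ∈ P} ≠ ∅` there are `p₁, q₁, …, pₙ, qₙ ∈ P` (`n ≥ 1`) with
`g = p₁⁻¹q₁⋯pₙ⁻¹qₙ` and `{x ∈ P : gx ∈ P} = qₙ⁻¹(pₙ(⋯(q₁⁻¹(p₁P))⋯))`. -/
def IsToeplitz (P : Submonoid G) : Prop :=
  ∀ g : G, {x : G | x ∈ P ∧ g * x ∈ P}.Nonempty →
    ∃ l : List (G × G), l ≠ [] ∧ (∀ pq ∈ l, pq.1 ∈ P ∧ pq.2 ∈ P) ∧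
      g = (l.map fun pq => pq.1⁻¹ * pq.2).prod ∧
      {x : G | x ∈ P ∧ g * x ∈ P} =
        l.foldl (fun S pq => presub P pq.2 (lmul pq.1 S)) (P : Set G)

/-- A `J`-valued filter. -/
def IsFilterOn {α : Type*} (J : Set (Set α)) (F : Set (Set α)) : Prop :=
  F ⊆ J ∧ (∀ X₁ ∈ F, ∀ X₂ ∈ J, X₁ ⊆ X₂ → X₂ ∈ F) ∧
    (∀ X₁ ∈ F, ∀ X₂ ∈ F, X₁ ∩ X₂ ∈ F) ∧ ∅ ∉ F

open Classical in
/-- Indicator function of a family of sets, with values in the discrete space `Bool`;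
this realizes a family as a point of the product space `{0,1}^(Set α)`. -/
noncomputable def chiF {α : Type*} (F : Set (Set α)) : Set α → Bool :=
  fun X => if X ∈ F then true else false

/-- `Σ`, the space of nonempty `𝒥`-valued filters, topologized as a subspace of
`{0,1}^𝒥` via indicator functions. -/
def SigmaT (P : Submonoid G) : Type _ :=
  {F : Set (Set G) // IsFilterOn {X : Set G | IsConstructible P X} F ∧ F.Nonempty}

noncomputable instance (P : Submonoid G) : TopologicalSpace (SigmaT P) :=
  TopologicalSpace.induced (fun F : SigmaT P => chiF F.1) inferInstance

/-- `pℱ = {X ∈ 𝒥 : p⁻¹X ∈ ℱ}`. -/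
def fwdF (P : Submonoid G) (p : G) (F : Set (Set G)) : Set (Set G) :=
  {X : Set G | IsConstructible P X ∧ presub P p X ∈ F}

/-- `p⁻¹𝒢 = {X ∈ 𝒥 : pX ∈ 𝒢}`. -/
def bwdF (P : Submonoid G) (p : G) (F : Set (Set G)) : Set (Set G) :=
  {X : Set G | IsConstructible P X ∧ lmul p X ∈ F}

/-- `ℱ` is a `𝒥`-valued ultrafilter: a maximal element of `Σ` w.r.t. inclusion. -/
def IsUltraFilterOn (P : Submonoid G) (F : Set (Set G)) : Prop :=
  (IsFilterOn {X : Set G | IsConstructible P X} F ∧ F.Nonempty) ∧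
    ∀ F' : Set (Set G), IsFilterOn {X : Set G | IsConstructible P X} F' → F'.Nonempty →
      F ⊆ F' → F' = F

/-- `Σ^G`, the space of nonempty `𝒥_P^G`-valued filters, topologized as a subspace of
`{0,1}^{𝒥_P^G}` via indicator functions. -/
def SigmaGT (P : Submonoid G) : Type _ :=
  {F : Set (Set G) // IsFilterOn {Y : Set G | IsConstructibleG P Y} F ∧ F.Nonempty}

noncomputable instance (P : Submonoid G) : TopologicalSpace (SigmaGT P) :=
  TopologicalSpace.induced (fun F : SigmaGT P => chiF F.1) inferInstance

/-- The right `G`-action on `𝒥_P^G`-valued filters: `ℱ̂·g = {Y ∈ 𝒥_P^G : g·Y ∈ ℱ̂}`. -/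
def actG (P : Submonoid G) (g : G) (F : Set (Set G)) : Set (Set G) :=
  {Y : Set G | IsConstructibleG P Y ∧ lmul g Y ∈ F}

/-- `ι(ℱ) = {Y ∈ 𝒥_P^G : Y ∩ P ∈ ℱ}`, embedding `𝒥`-valued filters into `𝒥_P^G`-valued
filters. -/
def iotaF (P : Submonoid G) (F : Set (Set G)) : Set (Set G) :=
  {Y : Set G | IsConstructibleG P Y ∧ (Y ∩ (P : Set G)) ∈ F}

/-- The boundary space `(∂Σ)·G = {ι(ℱ)·g : ℱ ∈ ∂Σ, g ∈ G} ⊆ Σ^G`, where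
`∂Σ = closure Σ_max`. -/
def bdOrbit (P : Submonoid G) : Set (SigmaGT P) :=
  {Fh : SigmaGT P | ∃ F : SigmaT P,
    F ∈ closure {E : SigmaT P | IsUltraFilterOn P E.1} ∧
      ∃ g : G, Fh.1 = actG P g (iotaF P F.1)}

/-- `G₀ = {g ∈ G : (g·P) ∩ X ≠ ∅ and (g⁻¹·P) ∩ X ≠ ∅ for all nonempty X ∈ 𝒥}`. -/
def Gzero (P : Submonoid G) : Set G :=
  {g : G | ∀ X : Set G, IsConstructible P X → X.Nonempty →
    (lmul g (P : Set G) ∩ X).Nonempty ∧ (lmul g⁻¹ (P : Set G) ∩ X).Nonempty}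

theorem mem_lmul {g x : G} {X : Set G} : x ∈ lmul g X ↔ g⁻¹ * x ∈ X := by
  constructor
  · rintro ⟨y, hy, rfl⟩
    simpa using hy
  · intro h
    exact ⟨g⁻¹ * x, h, by simp⟩

theorem lmul_lmul (g h : G) (X : Set G) : lmul g (lmul h X) = lmul (g * h) X := by
  ext x
  simp [mem_lmul, mul_assoc]

@[simp] theorem lmul_one (X : Set G) : lmul 1 X = X := by
  ext x
  simp [mem_lmul]

theorem lmul_mono (g : G) {X Y : Set G} (h : X ⊆ Y) : lmul g X ⊆ lmul g Y :=
  Set.image_mono h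

theorem lmul_inter (g : G) (X Y : Set G) : lmul g (X ∩ Y) = lmul g X ∩ lmul g Y := by
  ext x
  simp [mem_lmul]

@[simp] theorem lmul_empty (g : G) : lmul g (∅ : Set G) = ∅ := by
  simp [lmul]

variable {P : Submonoid G}

theorem IsConstructible.subset {X : Set G} (hX : IsConstructible P X) : X ⊆ P := by
  induction hX with
  | empty => simp
  | base => exact subset_rfl
  | mul hp _ ih =>
    rintro _ ⟨y, hy, rfl⟩
    exact P.mul_mem hp (ih hy)
  | pre _ _ _ => exact fun _ hy => hy.1

/-- Constructible right ideals are right ideals. -/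
theorem IsConstructible.mul_mem {X : Set G} (hX : IsConstructible P X) {x y : G} (hx : x ∈ X)
    (hy : y ∈ P) : x * y ∈ X := by
  induction hX generalizing x with
  | empty => exact hx
  | base => exact P.mul_mem hx hy
  | mul _ _ ih =>
    rw [mem_lmul] at hx ⊢
    simpa [mul_assoc] using ih hx
  | pre _ _ ih => exact ⟨P.mul_mem hx.1 hy, by simpa [mul_assoc] using ih hx.2⟩

theorem IsConstructible.inter {X Y : Set G} (hX : IsConstructible P X)
    (hY : IsConstructible P Y) : IsConstructible P (X ∩ Y) := by
  induction hX generalizing Y with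
  | empty => simpa using IsConstructible.empty
  | base => rwa [Set.inter_eq_right.2 hY.subset]
  | @mul p hp X hX ih =>
    have : lmul p X ∩ Y = lmul p (X ∩ presub P p Y) := by
      ext x
      have : p⁻¹ * x ∈ X → p⁻¹ * x ∈ P := fun h => hX.subset h
      simp only [Set.mem_inter_iff, mem_lmul, presub, Set.mem_ofPred_eq, mul_inv_cancel_left]
      tauto
    rw [this]
    exact .mul hp (ih (.pre hp hY))
  | @pre p hp X hX ih =>
    have : presub P p X ∩ Y = presub P p (X ∩ lmul p Y) := by
      ext x
      simp only [Set.mem_inter_iff, mem_lmul, presub, Set.mem_ofPred_eq, inv_mul_cancel_left]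
      tauto
    rw [this]
    exact .pre hp (ih (.mul hp hY))

theorem foldl_presub_lmul_eq (l : List (G × G)) {S T : Set G} (hST : S ⊆ T) :
    l.foldl (fun S pq => presub P pq.2 (lmul pq.1 S)) S =
      {y | y ∈ l.foldl (fun S pq => presub P pq.2 (lmul pq.1 S)) T ∧
        (l.map fun pq => pq.1⁻¹ * pq.2).prod * y ∈ S} := by
  induction l generalizing S T with
  | nil =>
    ext y
    simpa using fun h => hST h
  | cons pq l ih =>
    have hsub : presub P pq.2 (lmul pq.1 S) ⊆ presub P pq.2 (lmul pq.1 T) :=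
      fun y hy => ⟨hy.1, lmul_mono _ hST hy.2⟩
    have hT := ih (subset_refl (presub P pq.2 (lmul pq.1 T)))
    ext y
    have h1 := Set.ext_iff.1 (ih hsub) y
    have h2 := Set.ext_iff.1 hT y
    simp only [Set.mem_ofPred_eq, List.foldl_cons, List.map_cons, List.prod_cons, presub,
      mem_lmul, mul_assoc] at h1 h2 ⊢
    tauto

theorem IsConstructible.foldl {l : List (G × G)} (hl : ∀ pq ∈ l, pq.1 ∈ P ∧ pq.2 ∈ P)
    {S : Set G} (hS : IsConstructible P S) :
    IsConstructible P (l.foldl (fun S pq => presub P pq.2 (lmul pq.1 S)) S) := by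
  induction l generalizing S with
  | nil => exact hS
  | cons pq l ih =>
    have h := hl pq (by simp)
    exact ih (fun a ha => hl a (by simp [ha])) (.pre h.2 (.mul h.1 hS))

theorem IsToeplitz.lmul_inter (hT : IsToeplitz P) (g : G) {X : Set G}
    (hX : IsConstructible P X) : IsConstructible P (lmul g X ∩ P) := by
  by_cases h : {x : G | x ∈ P ∧ g⁻¹ * x ∈ P}.Nonempty
  · obtain ⟨l, -, hl, hg, hD⟩ := hT g⁻¹ h
    have h1 := foldl_presub_lmul_eq (P := P) l hX.subset
    rw [← hD, ← hg] at h1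
    convert IsConstructible.foldl hl hX using 1
    rw [h1]
    ext y
    have : g⁻¹ * y ∈ X → g⁻¹ * y ∈ P := fun h => hX.subset h
    simp only [Set.mem_inter_iff, mem_lmul, Set.mem_ofPred_eq, SetLike.mem_coe]
    tauto
  · have : lmul g X ∩ P = ∅ := by
      refine Set.eq_empty_of_forall_notMem fun y hy => h ⟨y, hy.2, ?_⟩
      exact hX.subset (mem_lmul.1 hy.1)
    rw [this]
    exact .empty

theorem IsToeplitz.inter (hT : IsToeplitz P) {Y : Set G} (hY : IsConstructibleG P Y) :
    IsConstructible P (Y ∩ P) := by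
  suffices ∀ g, IsConstructible P (lmul g Y ∩ P) by simpa using this 1
  induction hY with
  | base hX => exact fun g => hT.lmul_inter g hX
  | translate h _ ih =>
    intro g
    rw [lmul_lmul]
    exact ih _
  | inter _ _ ih1 ih2 =>
    intro g
    rw [_root_.lmul_inter, Set.inter_inter_distrib_right]
    exact (ih1 g).inter (ih2 g)

theorem isConstructibleG_lmul_iff {g : G} {Y : Set G} :
    IsConstructibleG P (lmul g Y) ↔ IsConstructibleG P Y :=
  ⟨fun h => by simpa [lmul_lmul] using h.translate g⁻¹, fun h => h.translate g⟩

theorem actG_actG (a b : G) (F : Set (Set G)) : actG P b (actG P a F) = actG P (a * b) F := by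
  ext Y
  simp only [actG, Set.mem_ofPred_eq, lmul_lmul, isConstructibleG_lmul_iff]
  tauto

theorem actG_one {F : Set (Set G)} (hF : F ⊆ {Y | IsConstructibleG P Y}) : actG P 1 F = F := by
  ext Y
  simpa [actG] using fun h => hF h

theorem mem_actG_iotaF {h : G} {F : Set (Set G)} {Y : Set G} :
    Y ∈ actG P h (iotaF P F) ↔ IsConstructibleG P Y ∧ lmul h Y ∩ P ∈ F := by
  simp only [actG, iotaF, Set.mem_ofPred_eq, isConstructibleG_lmul_iff]
  tauto

/-- The action of `g` on `Σ^G`. -/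
def SigmaGT.act (g : G) (F : SigmaGT P) : SigmaGT P :=
  ⟨actG P g F.1, by
    obtain ⟨F, ⟨hJ, hup, hint, hne⟩, Y, hY⟩ := F
    refine ⟨⟨fun _ h => h.1, ?_, ?_, ?_⟩, lmul g⁻¹ Y, ?_, ?_⟩
    · rintro X₁ h₁ X₂ h₂ hs
      exact ⟨h₂, hup _ h₁.2 _ (h₂.translate g) (lmul_mono g hs)⟩
    · rintro X₁ h₁ X₂ h₂
      exact ⟨h₁.1.inter h₂.1, lmul_inter g X₁ X₂ ▸ hint _ h₁.2 _ h₂.2⟩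
    · exact fun h => hne (by simpa using h.2)
    · exact (hJ hY).translate _
    · simpa [lmul_lmul] using hY⟩

theorem SigmaT.coe_mem (F : SigmaT P) : (P : Set G) ∈ F.1 := by
  obtain ⟨F, ⟨hJ, hup, -, -⟩, X, hX⟩ := F
  exact hup X hX _ .base (hJ hX).subset

/-- The map `ι : Σ → Σ^G`. -/
def SigmaT.iota (hT : IsToeplitz P) (F : SigmaT P) : SigmaGT P :=
  ⟨iotaF P F.1, by
    have hP := F.coe_mem
    obtain ⟨-, hup, hint, hne⟩ := F.2.1
    refine ⟨⟨fun _ h => h.1, ?_, ?_, ?_⟩, P, .base .base, by simpa using hP⟩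
    · rintro X₁ h₁ X₂ h₂ hs
      exact ⟨h₂, hup _ h₁.2 _ (hT.inter h₂) (Set.inter_subset_inter_left _ hs)⟩
    · rintro X₁ h₁ X₂ h₂
      exact ⟨h₁.1.inter h₂.1, Set.inter_inter_distrib_right X₁ X₂ P ▸ hint _ h₁.2 _ h₂.2⟩
    · exact fun h => hne (by simpa using h.2)⟩

theorem chiF_congr {α : Type*} {F F' : Set (Set α)} {X Y : Set α} (h : X ∈ F ↔ Y ∈ F') :
    chiF F X = chiF F' Y := by
  simp [chiF, h]

theorem continuous_chiF_sigmaT (X : Set G) : Continuous fun F : SigmaT P => chiF F.1 X :=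
  (continuous_apply (A := fun _ : Set G => Bool) X).comp
    (continuous_induced_dom (f := fun F : SigmaT P => chiF F.1))

theorem continuous_chiF_sigmaGT (Y : Set G) : Continuous fun F : SigmaGT P => chiF F.1 Y :=
  (continuous_apply (A := fun _ : Set G => Bool) Y).comp
    (continuous_induced_dom (f := fun F : SigmaGT P => chiF F.1))

theorem SigmaGT.continuous_act (g : G) : Continuous (SigmaGT.act (P := P) g) := by
  refine continuous_induced_rng.2 (continuous_pi fun Y => ?_)
  by_cases hY : IsConstructibleG P Y
  · convert continuous_chiF_sigmaGT (P := P) (lmul g Y) using 2 with F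
    exact chiF_congr (and_iff_right hY)
  · convert continuous_const (y := false) using 2 with F
    simp [chiF, SigmaGT.act, actG, hY]

theorem SigmaT.continuous_iota (hT : IsToeplitz P) : Continuous (SigmaT.iota hT) := by
  refine continuous_induced_rng.2 (continuous_pi fun Y => ?_)
  by_cases hY : IsConstructibleG P Y
  · convert continuous_chiF_sigmaT (P := P) (Y ∩ P) using 2 with F
    exact chiF_congr (and_iff_right hY)
  · convert continuous_const (y := false) using 2 with F
    simp [chiF, SigmaT.iota, iotaF, hY]

theorem SigmaGT.act_mem_bdOrbit (g : G) {z : SigmaGT P} (hz : z ∈ bdOrbit P) :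
    z.act g ∈ bdOrbit P := by
  obtain ⟨F, hF, h, hz⟩ := hz
  exact ⟨F, hF, h * g, by simp [SigmaGT.act, hz, actG_actG]⟩

/-- The action of `g` on the boundary space `(∂Σ)·G`. -/
def bdAct (g : G) (z : bdOrbit P) : bdOrbit P := ⟨z.1.act g, SigmaGT.act_mem_bdOrbit g z.2⟩

theorem continuous_bdAct (g : G) : Continuous (bdAct (P := P) g) :=
  ((SigmaGT.continuous_act g).comp continuous_subtype_val).subtype_mk _

theorem bdAct_val (g : G) (z : bdOrbit P) : (bdAct g z).1.1 = actG P g z.1.1 := rfl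

theorem actG_one_bdOrbit (z : bdOrbit P) : actG P 1 z.1.1 = z.1.1 :=
  actG_one z.1.2.1.1

/-- Conjugation preserves the property that fixed points have nonempty interior. -/
theorem interior_fixed_conj_nonempty {g : G} (k : G)
    (h : (interior {z : bdOrbit P | actG P g z.1.1 = z.1.1}).Nonempty) :
    (interior {z : bdOrbit P | actG P (k * g * k⁻¹) z.1.1 = z.1.1}).Nonempty := by
  obtain ⟨z, hz⟩ := h
  have hsub : bdAct k ⁻¹' {z : bdOrbit P | actG P g z.1.1 = z.1.1} ⊆
      {z : bdOrbit P | actG P (k * g * k⁻¹) z.1.1 = z.1.1} := by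
    intro w hw
    have := congrArg (actG P k⁻¹) (show actG P g (actG P k w.1.1) = actG P k w.1.1 from hw)
    simpa [actG_actG, mul_assoc, actG_one_bdOrbit] using this
  refine ⟨bdAct k⁻¹ z, interior_mono hsub
    (preimage_interior_subset_interior_preimage (continuous_bdAct k) ?_)⟩
  have : bdAct k (bdAct k⁻¹ z) = z :=
    Subtype.ext (Subtype.ext (by simp [bdAct_val, actG_actG, actG_one_bdOrbit]))
  rwa [Set.mem_preimage, this]

theorem exists_isUltraFilterOn {X : Set G} (hX : IsConstructible P X) (hne : X.Nonempty) :
    ∃ F, IsUltraFilterOn P F ∧ X ∈ F := by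
  obtain ⟨M, hM0, hM⟩ := zorn_subset_nonempty
    {F : Set (Set G) | IsFilterOn {X : Set G | IsConstructible P X} F} (by
      intro c hc hchain hcne
      refine ⟨⋃₀ c, ⟨?_, ?_, ?_, ?_⟩, fun s hs => Set.subset_sUnion_of_mem hs⟩
      · exact Set.sUnion_subset fun s hs => (hc hs).1
      · rintro X₁ ⟨s, hs, h₁⟩ X₂ h₂ h
        exact ⟨s, hs, (hc hs).2.1 X₁ h₁ X₂ h₂ h⟩
      · rintro X₁ ⟨s, hs, h₁⟩ X₂ ⟨t, ht, h₂⟩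
        rcases hchain.total hs ht with h | h
        · exact ⟨t, ht, (hc ht).2.2.1 X₁ (h h₁) X₂ h₂⟩
        · exact ⟨s, hs, (hc hs).2.2.1 X₁ h₁ X₂ (h h₂)⟩
      · rintro ⟨s, hs, h⟩
        exact (hc hs).2.2.2 h)
    {Y | IsConstructible P Y ∧ X ⊆ Y}
    ⟨fun _ h => h.1, fun _ h₁ _ h₂ h => ⟨h₂, h₁.2.trans h⟩,
      fun _ h₁ _ h₂ => ⟨h₁.1.inter h₂.1, Set.subset_inter h₁.2 h₂.2⟩,
      fun h => hne.ne_empty (Set.subset_empty_iff.1 h.2)⟩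
  have hXM : X ∈ M := hM0 ⟨hX, subset_rfl⟩
  exact ⟨M, ⟨⟨hM.1, X, hXM⟩, fun F' hF' _ h => (hM.eq_of_subset hF' h).symm⟩, hXM⟩

theorem IsUltraFilterOn.exists_disjoint {E : Set (Set G)} (hE : IsUltraFilterOn P E) {X : Set G}
    (hX : IsConstructible P X) (hXE : X ∉ E) : ∃ Y ∈ E, Y ∩ X = ∅ := by
  by_contra! hcon
  obtain ⟨⟨⟨hJ, hup, hint, hne⟩, Z, hZ⟩, hmax⟩ := hE
  refine hXE ?_
  rw [← hmax {W | IsConstructible P W ∧ ∃ Y ∈ E, Y ∩ X ⊆ W}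
    ⟨fun _ h => h.1, ?_, ?_, ?_⟩ ⟨X, hX, Z, hZ, Set.inter_subset_right⟩
    fun Y hY => ⟨hJ hY, Y, hY, Set.inter_subset_left⟩]
  · exact ⟨hX, Z, hZ, Set.inter_subset_right⟩
  · rintro _ ⟨_, Y, hY, h₁⟩ _ h₂ h
    exact ⟨h₂, Y, hY, h₁.trans h⟩
  · rintro _ ⟨c₁, Y₁, hY₁, h₁⟩ _ ⟨c₂, Y₂, hY₂, h₂⟩
    refine ⟨c₁.inter c₂, Y₁ ∩ Y₂, hint _ hY₁ _ hY₂, ?_⟩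
    rw [Set.inter_inter_distrib_right]
    exact Set.inter_subset_inter h₁ h₂
  · rintro ⟨-, Y, hY, h⟩
    exact (hcon Y hY).ne_empty (Set.subset_empty_iff.1 h)

/-- At an ultrafilter `E` the sets `{F | X ∈ F}` with `X ∈ E` form a neighbourhood basis. -/
theorem IsUltraFilterOn.exists_subset_of_isOpen {E : SigmaT P} (hE : IsUltraFilterOn P E.1)
    {V : Set (SigmaT P)} (hV : IsOpen V) (hEV : E ∈ V) :
    ∃ X ∈ E.1, ∀ F : SigmaT P, X ∈ F.1 → F ∈ V := by
  obtain ⟨W, hW, rfl⟩ := isOpen_induced_iff.1 hV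
  obtain ⟨I, u, hu, hIu⟩ := isOpen_pi_iff.1 hW _ hEV
  have key : ∀ Y : Set G, ∃ X ∈ E.1, ∀ F : SigmaT P, X ∈ F.1 → (Y ∈ F.1 ↔ Y ∈ E.1) := by
    intro Y
    by_cases hYE : Y ∈ E.1
    · exact ⟨Y, hYE, fun F h => iff_of_true h hYE⟩
    by_cases hY : IsConstructible P Y
    · obtain ⟨X, hX, hd⟩ := hE.exists_disjoint hY hYE
      exact ⟨X, hX, fun F h => iff_of_false
        (fun h' => F.2.1.2.2.2 (hd ▸ F.2.1.2.2.1 X h Y h')) hYE⟩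
    · exact ⟨P, E.coe_mem, fun F _ => iff_of_false (fun h => hY (F.2.1.1 h)) hYE⟩
  have fin : ∀ I : Finset (Set G),
      ∃ X ∈ E.1, ∀ F : SigmaT P, X ∈ F.1 → ∀ Y ∈ I, (Y ∈ F.1 ↔ Y ∈ E.1) := by
    classical
    intro I
    induction I using Finset.induction_on with
    | empty => exact ⟨P, E.coe_mem, by simp⟩
    | insert Y I _ ih =>
      obtain ⟨X₁, h₁, h₁'⟩ := ih
      obtain ⟨X₂, h₂, h₂'⟩ := key Y
      refine ⟨X₁ ∩ X₂, E.2.1.2.2.1 _ h₁ _ h₂, fun F hF => ?_⟩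
      have m₁ := F.2.1.2.1 _ hF X₁ (E.2.1.1 h₁) Set.inter_subset_left
      have m₂ := F.2.1.2.1 _ hF X₂ (E.2.1.1 h₂) Set.inter_subset_right
      simpa using ⟨h₂' F m₂, h₁' F m₁⟩
  obtain ⟨X, hX, h⟩ := fin I
  refine ⟨X, hX, fun F hF => hIu fun Y hY => ?_⟩
  have : chiF F.1 Y = chiF E.1 Y := chiF_congr (h F hF Y hY)
  change chiF F.1 Y ∈ u Y
  rw [this]
  exact (hu Y hY).2

theorem presub_coe {p : G} (hp : p ∈ P) : presub P p P = P := by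
  ext y
  simpa [presub] using fun hy => P.mul_mem hp hy

theorem presub_lmul {p : G} {X : Set G} (hX : IsConstructible P X) :
    presub P p (lmul p X) = X := by
  ext y
  simpa [presub, mem_lmul] using fun hy => hX.subset hy

theorem lmul_presub {p : G} (X : Set G) : lmul p (presub P p X) = X ∩ lmul p P := by
  ext y
  simp [presub, mem_lmul, and_comm]

theorem isFilterOn_fwdF {p : G} (hp : p ∈ P) {F : Set (Set G)}
    (hF : IsFilterOn {X : Set G | IsConstructible P X} F) :
    IsFilterOn {X : Set G | IsConstructible P X} (fwdF P p F) := by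
  obtain ⟨-, hup, hint, hne⟩ := hF
  refine ⟨fun _ h => h.1, ?_, ?_, fun h => hne (by simpa [presub] using h.2)⟩
  · rintro _ ⟨_, h₁⟩ _ h₂ h
    exact ⟨h₂, hup _ h₁ _ (.pre hp h₂) fun y hy => ⟨hy.1, h hy.2⟩⟩
  · rintro X₁ ⟨c₁, h₁⟩ X₂ ⟨c₂, h₂⟩
    refine ⟨c₁.inter c₂, ?_⟩
    have : presub P p (X₁ ∩ X₂) = presub P p X₁ ∩ presub P p X₂ := by
      ext
      simp only [presub, Set.mem_ofPred_eq, Set.mem_inter_iff]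
      tauto
    exact this ▸ hint _ h₁ _ h₂

theorem IsUltraFilterOn.fwdF {p : G} (hp : p ∈ P) {F : Set (Set G)}
    (hF : IsUltraFilterOn P F) : IsUltraFilterOn P (fwdF P p F) := by
  have hPF : (P : Set G) ∈ F := SigmaT.coe_mem ⟨F, hF.1⟩
  refine ⟨⟨isFilterOn_fwdF hp hF.1.1, P, .base, (presub_coe hp).symm ▸ hPF⟩,
    fun F' hF' _ hsub => (hsub.antisymm ?_).symm⟩
  obtain ⟨hJ, hup, hint, hne⟩ := hF'
  have hle : F ⊆ bwdF P p F' := fun X hX =>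
    ⟨hF.1.1.1 hX, hsub ⟨.mul hp (hF.1.1.1 hX), (presub_lmul (hF.1.1.1 hX)).symm ▸ hX⟩⟩
  have heq : bwdF P p F' = F := by
    refine hF.2 _ ⟨fun _ h => h.1, ?_, ?_, fun h => hne (by simpa using h.2)⟩ ⟨P, hle hPF⟩ hle
    · rintro _ ⟨_, h₁⟩ _ h₂ h
      exact ⟨h₂, hup _ h₁ _ (.mul hp h₂) (lmul_mono p h)⟩
    · rintro _ ⟨c₁, h₁⟩ _ ⟨c₂, h₂⟩
      exact ⟨c₁.inter c₂, lmul_inter p _ _ ▸ hint _ h₁ _ h₂⟩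
  intro Y hY
  refine ⟨hJ hY, ?_⟩
  rw [← heq]
  refine ⟨.pre hp (hJ hY), ?_⟩
  rw [lmul_presub]
  exact hint _ hY _ (hle hPF).2

theorem iotaF_fwdF (hT : IsToeplitz P) {p : G} (hp : p ∈ P) (F : Set (Set G)) :
    iotaF P (fwdF P p F) = actG P p⁻¹ (iotaF P F) := by
  ext Y
  have : presub P p (Y ∩ P) = lmul p⁻¹ Y ∩ P := by
    ext y
    have : y ∈ P → p * y ∈ P := P.mul_mem hp
    simp only [presub, Set.mem_ofPred_eq, Set.mem_inter_iff, mem_lmul, inv_inv, SetLike.mem_coe]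
    tauto
  rw [mem_actG_iotaF, ← this]
  exact ⟨fun h => ⟨h.1, h.2.2⟩, fun h => ⟨h.1, hT.inter h.1, h.2⟩⟩

/-- An element fixing `ι(F)` for all ultrafilters `F` lies in `G₀`. -/
theorem mem_Gzero_of_fixed {g : G}
    (h : ∀ F, IsUltraFilterOn P F → actG P g (iotaF P F) = iotaF P F) : g ∈ Gzero P := by
  have key : ∀ k : G, (∀ F, IsUltraFilterOn P F → actG P k (iotaF P F) = iotaF P F) →
      ∀ X : Set G, IsConstructible P X → X.Nonempty → (lmul k (P : Set G) ∩ X).Nonempty := by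
    intro k hk X hX hne
    obtain ⟨F, hF, hXF⟩ := exists_isUltraFilterOn hX hne
    have hP : (P : Set G) ∈ iotaF P F :=
      ⟨.base .base, by simpa using SigmaT.coe_mem ⟨F, hF.1⟩⟩
    rw [← hk F hF, mem_actG_iotaF] at hP
    have hmem := hF.1.1.2.2.1 _ hP.2 _ hXF
    refine Set.Nonempty.mono (Set.inter_subset_inter_left X Set.inter_subset_left)
      (Set.nonempty_iff_ne_empty.2 fun h0 => hF.1.1.2.2.2 (h0 ▸ hmem))
  refine fun X hX hne => ⟨key g h X hX hne, key g⁻¹ (fun F hF => ?_) X hX hne⟩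
  conv_lhs => rw [← h F hF, actG_actG, mul_inv_cancel]
  exact actG_one fun _ h => h.1

/-- If `g` fixes an open set of boundary points, some conjugate of `g` lies in `G₀`. -/
theorem exists_conj_mem_Gzero (hT : IsToeplitz P) {g : G}
    (h : (interior {z : bdOrbit P | actG P g z.1.1 = z.1.1}).Nonempty) :
    ∃ k : G, k * g * k⁻¹ ∈ Gzero P := by
  obtain ⟨z, hz⟩ := h
  obtain ⟨F, hF, h, hzF⟩ := z.2
  obtain ⟨W, hW, hWi⟩ := isOpen_induced_iff.1
    (isOpen_interior (s := {z : bdOrbit P | actG P g z.1.1 = z.1.1}))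
  have hcont : Continuous fun F => (SigmaT.iota hT F).act h :=
    (SigmaGT.continuous_act h).comp (SigmaT.continuous_iota hT)
  have hV := hW.preimage hcont
  have hFV : (SigmaT.iota hT F).act h ∈ W := by
    have hzW : z.1 ∈ W := by rwa [← hWi] at hz
    rwa [show (SigmaT.iota hT F).act h = z.1 from Subtype.ext hzF.symm]
  obtain ⟨E, hEV, hE⟩ := mem_closure_iff.1 hF _ hV hFV
  obtain ⟨X, hX, hXV⟩ := IsUltraFilterOn.exists_subset_of_isOpen hE hV hEV
  have hXJ : IsConstructible P X := E.2.1.1 hX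
  obtain ⟨p, hpX⟩ : X.Nonempty :=
    Set.nonempty_iff_ne_empty.2 fun h0 => E.2.1.2.2.2 (h0 ▸ hX)
  have hp : p ∈ P := hXJ.subset hpX
  refine ⟨p⁻¹ * h, mem_Gzero_of_fixed fun F' hF' => ?_⟩
  have hU := hF'.fwdF hp
  let F'' : SigmaT P := ⟨fwdF P p F', hU.1⟩
  have hXF'' : X ∈ F''.1 := by
    refine ⟨hXJ, ?_⟩
    have : presub P p X = P := by
      ext y
      simpa [presub] using fun hy => hXJ.mul_mem hpX hy
    exact this ▸ SigmaT.coe_mem ⟨F', hF'.1⟩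
  let w : bdOrbit P := ⟨(SigmaT.iota hT F'').act h, F'', subset_closure hU, h, rfl⟩
  have hw : w ∈ interior {z : bdOrbit P | actG P g z.1.1 = z.1.1} := by
    rw [← hWi]
    exact hXV F'' hXF''
  have hfix : actG P g (actG P h (iotaF P (fwdF P p F'))) = actG P h (iotaF P (fwdF P p F')) :=
    interior_subset (s := {z : bdOrbit P | actG P g z.1.1 = z.1.1}) hw
  rw [iotaF_fwdF hT hp, actG_actG, actG_actG, actG_actG] at hfix
  rw [← actG_actG, mul_assoc, hfix, actG_actG, mul_inv_cancel]
  exact actG_one fun _ h => h.1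

/-- Assume `𝒥` is independent and `P ⊆ G` is Toeplitz. Then `G` acts topologically
freely on `(∂Σ)·G` if and only if the subgroup `G₀` acts topologically freely on
`(∂Σ)·G`. -/
theorem stmt_14 (P : Submonoid G)
    (hind : IsIndepFamily {X : Set G | IsConstructible P X}) (hT : IsToeplitz P) :
    (∀ g : G, g ≠ 1 →
        interior {z : ↥(bdOrbit P) | actG P g z.1.1 = z.1.1} = (∅ : Set ↥(bdOrbit P))) ↔
      ∀ g ∈ Gzero P, g ≠ 1 →
        interior {z : ↥(bdOrbit P) | actG P g z.1.1 = z.1.1} = (∅ : Set ↥(bdOrbit P)) := by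
  refine ⟨fun h g _ => h g, fun h g hg => ?_⟩
  by_contra hne
  have hne := Set.nonempty_iff_ne_empty.2 hne
  obtain ⟨k, hk⟩ := exists_conj_mem_Gzero hT hne
  exact (interior_fixed_conj_nonempty k hne).ne_empty (h _ hk (by simpa [conj_eq_one_iff] using hg))
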